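/- arXiv:2212.13250 — 2 statements merged into one kernel-verified Lean document; each statement's English description precedes it below -/
import Mathlib

section
/- In the decision problem with Θ = A = ℕ and loss ℓ(θ,a) = max(-1, min(1, θ - a)): for every probability measure μ on ℕ, the worst-case risk equals 1, that is, ⨆_{θ ∈ ℕ} ∫_ℕ ℓ(θ,a) μ(da) = 1. -/
open MeasureTheory

/-- The loss `ℓ(θ,a) = max(-1, min(1, θ - a))` on `Θ = A = ℕ`. -/
noncomputable def loss (θ a : ℕ) : ℝ := max (-1) (min 1 ((θ : ℝ) - (a : ℝ)))

theorem abs_loss_le_one (θ a : ℕ) : |loss θ a| ≤ 1 :=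
  abs_le.2 ⟨le_max_left _ _, max_le (by norm_num) (min_le_left _ _)⟩

theorem loss_eq_one_of_lt {θ a : ℕ} (h : a < θ) : loss θ a = 1 := by
  have h' : (a : ℝ) + 1 ≤ θ := by exact_mod_cast h
  rw [loss, min_eq_left (by linarith), max_eq_right (by norm_num)]

theorem integral_loss_le_one (μ : Measure ℕ) [IsProbabilityMeasure μ] (θ : ℕ) :
    ∫ a, loss θ a ∂μ ≤ 1 := by
  have h := norm_integral_le_of_norm_le_const (μ := μ) (f := loss θ) (C := 1)
    (Filter.Eventually.of_forall (abs_loss_le_one θ))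
  simp only [probReal_univ, mul_one] at h
  exact (le_abs_self _).trans h

theorem tendsto_integral_loss (μ : Measure ℕ) [IsProbabilityMeasure μ] :
    Filter.Tendsto (fun θ : ℕ => ∫ a, loss θ a ∂μ) Filter.atTop (nhds 1) := by
  have h := tendsto_integral_of_dominated_convergence (μ := μ) (F := loss) (f := fun _ => 1)
    (fun _ => 1) (fun θ => (Measurable.of_discrete (f := loss θ)).aestronglyMeasurable)
    (integrable_const 1) (fun θ => Filter.Eventually.of_forall (abs_loss_le_one θ))
    (Filter.Eventually.of_forall fun a => tendsto_const_nhds.congr'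
      ((Filter.eventually_gt_atTop a).mono fun _ hθ => (loss_eq_one_of_lt hθ).symm))
  simpa using h

/-- For every randomized procedure `μ` (a probability measure on `ℕ`), the worst-case risk
equals `1`. -/
theorem stmt15 (μ : Measure ℕ) (hμ : IsProbabilityMeasure μ) :
    (⨆ θ : ℕ, ∫ a, loss θ a ∂μ) = 1 := by
  exact ciSup_eq_of_forall_le_of_forall_lt_exists_gt (integral_loss_le_one μ)
    fun _ hw => ((tendsto_integral_loss μ).eventually_const_lt hw).exists
end

section
/- In the decision problem with Θ = A = ℕ and loss ℓ(θ,a) = max(-1, min(1, θ - a)): for every countably additive probability measure π on ℕ, the infimum over nonrandomized procedures equals -1, that is, ⨅_{a ∈ ℕ} ∫_ℕ ℓ(θ,a) π(dθ) = -1. Consequently the minimax equality fails for this problem, since the minimax value is 1 while the maximin value over countably additive priors is -1. -/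
open MeasureTheory

theorem neg_one_le_loss (θ a : ℕ) : -1 ≤ loss θ a := le_max_left _ _

theorem loss_le_one (θ a : ℕ) : loss θ a ≤ 1 :=
  max_le (by norm_num) (min_le_left _ _)

theorem norm_loss_le_one (θ a : ℕ) : ‖loss θ a‖ ≤ 1 :=
  abs_le.2 ⟨neg_one_le_loss θ a, loss_le_one θ a⟩

theorem loss_eq_neg_one {θ a : ℕ} (h : θ + 1 ≤ a) : loss θ a = -1 := by
  have h' : (θ : ℝ) + 1 ≤ a := by exact_mod_cast h
  exact max_eq_left ((min_le_right _ _).trans (by linarith))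

theorem loss_eq_one {θ a : ℕ} (h : a + 1 ≤ θ) : loss θ a = 1 := by
  have h' : (a : ℝ) + 1 ≤ θ := by exact_mod_cast h
  rw [loss, min_eq_left (by linarith), max_eq_right (by norm_num)]

theorem integrable_of_norm_le_one {μ : Measure ℕ} [IsFiniteMeasure μ] {f : ℕ → ℝ}
    (hf : ∀ n, ‖f n‖ ≤ 1) : Integrable f μ :=
  .of_bound (measurable_of_countable f).aestronglyMeasurable 1 (ae_of_all _ hf)

theorem tendsto_integral_of_norm_le_one {μ : Measure ℕ} [IsProbabilityMeasure μ]
    {F : ℕ → ℕ → ℝ} {c : ℝ} (hF : ∀ k n, ‖F k n‖ ≤ 1)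
    (h : ∀ n, ∀ k, n + 1 ≤ k → F k n = c) :
    Filter.Tendsto (fun k ↦ ∫ n, F k n ∂μ) Filter.atTop (nhds c) := by
  have := tendsto_integral_of_dominated_convergence (μ := μ) (F := F) (f := fun _ ↦ c) (fun _ ↦ 1)
    (fun k ↦ (measurable_of_countable (F k)).aestronglyMeasurable) (integrable_const 1)
    (fun k ↦ ae_of_all _ (hF k))
    (ae_of_all _ fun n ↦ tendsto_const_nhds.congr'
      (Filter.eventually_atTop.2 ⟨n + 1, fun k hk ↦ (h n k hk).symm⟩))
  simpa using this

theorem iInf_integral_loss (π : Measure ℕ) [IsProbabilityMeasure π] :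
    (⨅ a : ℕ, ∫ θ, loss θ a ∂π) = -1 := by
  have hlow (a : ℕ) : -1 ≤ ∫ θ, loss θ a ∂π := by
    simpa using integral_mono (μ := π) (integrable_const (-1 : ℝ))
      (integrable_of_norm_le_one fun θ ↦ norm_loss_le_one θ a) fun θ ↦ neg_one_le_loss θ a
  refine le_antisymm (ge_of_tendsto' (tendsto_integral_of_norm_le_one (μ := π)
    (F := fun a θ ↦ loss θ a) (fun a θ ↦ norm_loss_le_one θ a) fun θ a h ↦ loss_eq_neg_one h)
    fun a ↦ ciInf_le ⟨-1, ?_⟩ a) (le_ciInf hlow)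
  rintro _ ⟨a, rfl⟩
  exact hlow a

theorem iSup_integral_loss (μ : Measure ℕ) [IsProbabilityMeasure μ] :
    (⨆ θ : ℕ, ∫ a, loss θ a ∂μ) = 1 := by
  have hup (θ : ℕ) : ∫ a, loss θ a ∂μ ≤ 1 := by
    simpa using integral_mono (μ := μ) (integrable_of_norm_le_one fun a ↦ norm_loss_le_one θ a)
      (integrable_const (1 : ℝ)) fun a ↦ loss_le_one θ a
  refine le_antisymm (ciSup_le hup) (le_of_tendsto' (tendsto_integral_of_norm_le_one (μ := μ)
    (F := loss) norm_loss_le_one fun a θ h ↦ loss_eq_one h)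
    fun θ ↦ le_ciSup (f := fun θ ↦ ∫ a, loss θ a ∂μ) ⟨1, ?_⟩ θ)
  rintro _ ⟨θ, rfl⟩
  exact hup θ

/-- For every countably additive prior `π` on `ℕ`, the infimum of the Bayes risk over
nonrandomized procedures equals `-1`; consequently the minimax equality fails, the minimax
value being `1` while the maximin value over countably additive priors is `-1`. -/
theorem stmt16 :
    (∀ π : Measure ℕ, IsProbabilityMeasure π → (⨅ a : ℕ, ∫ θ, loss θ a ∂π) = -1) ∧
    (⨅ μ : {μ : Measure ℕ // IsProbabilityMeasure μ}, ⨆ θ : ℕ, ∫ a, loss θ a ∂μ.1) = 1 ∧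
    (⨆ π : {π : Measure ℕ // IsProbabilityMeasure π}, ⨅ a : ℕ, ∫ θ, loss θ a ∂π.1) = -1 := by
  have : Nonempty {μ : Measure ℕ // IsProbabilityMeasure μ} := ⟨⟨Measure.dirac 0, inferInstance⟩⟩
  refine ⟨fun π _ ↦ iInf_integral_loss π, ?_, ?_⟩
  · rw [iInf_congr fun μ : {μ : Measure ℕ // IsProbabilityMeasure μ} ↦
      have := μ.2; iSup_integral_loss μ.1, ciInf_const]
  · rw [iSup_congr fun π : {π : Measure ℕ // IsProbabilityMeasure π} ↦
      have := π.2; iInf_integral_loss π.1, ciSup_const]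
end
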